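/- The geometric realization of the multiple chessboard complex Δ_{3,2}^{2,2} (a 3×2 chessboard with at most 2 rooks in each row and at most 2 rooks in each column) is homeomorphic to the sphere S^3. -/

import Mathlib

open scoped BigOperators

/-- A face of the multiple chessboard complex `Δ_{m,n}^{p,q}` (row capacities `k`,
column capacities `l`). -/
def IsFace (m n : ℕ) (k : Fin n → ℕ) (l : Fin m → ℕ)
    (A : Finset (Fin m × Fin n)) : Prop :=
  (∀ i : Fin n, (A.filter fun v => v.2 = i).card ≤ k i) ∧
  (∀ j : Fin m, (A.filter fun v => v.1 = j).card ≤ l j)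

/-- The geometric realization of the multiple chessboard complex. -/
def Realization (m n : ℕ) (k : Fin n → ℕ) (l : Fin m → ℕ) :
    Set ((Fin m × Fin n) → ℝ) :=
  {f | (∀ v, 0 ≤ f v ∧ f v ≤ 1) ∧ ∑ v, f v = 1 ∧
      IsFace m n k l (Finset.univ.filter fun v => 0 < f v)}

/-- A point of `Δ_{3,2}^{2,2}` is a probability vector vanishing somewhere in each row. -/
theorem mem_realization_iff {f : Fin 3 × Fin 2 → ℝ} :
    f ∈ Realization 3 2 (fun _ => 2) (fun _ => 2) ↔
      (∀ v, 0 ≤ f v) ∧ ∑ v, f v = 1 ∧ ∀ i, ∃ j, f (j, i) = 0 := by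
  constructor
  · rintro ⟨hf, hsum, hrow, -⟩
    refine ⟨fun v => (hf v).1, hsum, fun i => ?_⟩
    by_contra! hne
    have hsub : Finset.univ.image (fun j : Fin 3 => (j, i)) ⊆
        (Finset.univ.filter fun v => 0 < f v).filter fun v => v.2 = i := by
      intro v hv
      obtain ⟨j, -, rfl⟩ := Finset.mem_image.1 hv
      simpa using lt_of_le_of_ne (hf (j, i)).1 (hne j).symm
    have hcard := (Finset.card_le_card hsub).trans (hrow i)
    rw [Finset.card_image_of_injective _ (Prod.mk_left_injective i)] at hcard
    simp at hcard
  · rintro ⟨hf, hsum, hzero⟩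
    refine ⟨fun v => ⟨hf v, ?_⟩, hsum, fun i => ?_, fun j => ?_⟩
    · rw [← hsum]
      exact Finset.single_le_sum (fun w _ => hf w) (Finset.mem_univ v)
    · obtain ⟨j, hj⟩ := hzero i
      have hsub : ((Finset.univ.filter fun v => 0 < f v).filter fun v => v.2 = i) ⊆
          (Finset.univ.erase j).image fun j' => (j', i) := by
        rintro ⟨a, b⟩ hv
        simp only [Finset.mem_filter, Finset.mem_univ, true_and] at hv
        obtain ⟨hpos, rfl⟩ := hv
        simp only [Finset.mem_image, Finset.mem_erase, Finset.mem_univ, and_true]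
        refine ⟨a, ?_, rfl⟩
        rintro rfl
        exact hpos.ne' hj
      refine (Finset.card_le_card hsub).trans (Finset.card_image_le.trans ?_)
      simp
    · have hsub : ((Finset.univ.filter fun v => 0 < f v).filter fun v => v.1 = j) ⊆
          Finset.univ.image fun i : Fin 2 => (j, i) := by
        rintro ⟨a, b⟩ hv
        simp only [Finset.mem_filter, Finset.mem_univ, true_and] at hv
        simp [hv.2]
      refine (Finset.card_le_card hsub).trans (Finset.card_image_le.trans ?_)
      simp

/-- The coordinates of a pair of vectors in `ℝ³` modulo the diagonal, in each row. -/
noncomputable def rowDifferences (f : Fin 3 × Fin 2 → ℝ) : EuclideanSpace ℝ (Fin 4) :=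
  !₂[f (0, 0) - f (2, 0), f (1, 0) - f (2, 0), f (0, 1) - f (2, 1), f (1, 1) - f (2, 1)]

/-- The minimum of `0` and the two coordinates of `u` belonging to row `i`. -/
noncomputable def rowMin (u : EuclideanSpace ℝ (Fin 4)) (i : Fin 2) : ℝ :=
  ![min (min (u 0) (u 1)) 0, min (min (u 2) (u 3)) 0] i

/-- The lift of `u` along `rowDifferences` whose minimum in each row is zero. -/
noncomputable def coneLift (u : EuclideanSpace ℝ (Fin 4)) (v : Fin 3 × Fin 2) : ℝ :=
  ![![u 0, u 2], ![u 1, u 3], 0] v.1 v.2 - rowMin u v.2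

theorem rowDifferences_coneLift (u : EuclideanSpace ℝ (Fin 4)) :
    rowDifferences (coneLift u) = u := by
  ext k
  fin_cases k <;> simp [rowDifferences, coneLift]

theorem coneLift_nonneg (u : EuclideanSpace ℝ (Fin 4)) (v : Fin 3 × Fin 2) :
    0 ≤ coneLift u v := by
  obtain ⟨j, i⟩ := v
  fin_cases j <;> fin_cases i <;> simp [coneLift, rowMin]

theorem exists_coneLift_eq_zero (u : EuclideanSpace ℝ (Fin 4)) (i : Fin 2) :
    ∃ j, coneLift u (j, i) = 0 := by
  have key : ∀ a b : ℝ, a = min (min a b) 0 ∨ b = min (min a b) 0 ∨ 0 = min (min a b) 0 := by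
    grind
  fin_cases i
  · rcases key (u 0) (u 1) with h | h | h
    · exact ⟨0, sub_eq_zero.2 h⟩
    · exact ⟨1, sub_eq_zero.2 h⟩
    · exact ⟨2, sub_eq_zero.2 h⟩
  · rcases key (u 2) (u 3) with h | h | h
    · exact ⟨0, sub_eq_zero.2 h⟩
    · exact ⟨1, sub_eq_zero.2 h⟩
    · exact ⟨2, sub_eq_zero.2 h⟩

theorem rowMin_rowDifferences {f : Fin 3 × Fin 2 → ℝ} (hf : ∀ v, 0 ≤ f v)
    (hzero : ∀ i, ∃ j, f (j, i) = 0) (i : Fin 2) :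
    rowMin (rowDifferences f) i = -f (2, i) := by
  have key : ∀ a b c : ℝ, 0 ≤ a → 0 ≤ b → 0 ≤ c → (a = 0 ∨ b = 0 ∨ c = 0) →
      min (min (a - c) (b - c)) 0 = -c := by
    grind
  have h := key _ _ _ (hf (0, i)) (hf (1, i)) (hf (2, i))
    (by simpa [Fin.exists_fin_succ] using hzero i)
  fin_cases i <;> simpa [rowMin, rowDifferences] using h

theorem coneLift_rowDifferences {f : Fin 3 × Fin 2 → ℝ} (hf : ∀ v, 0 ≤ f v)
    (hzero : ∀ i, ∃ j, f (j, i) = 0) : coneLift (rowDifferences f) = f := by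
  funext ⟨j, i⟩
  rw [coneLift, rowMin_rowDifferences hf hzero]
  fin_cases j <;> fin_cases i <;> simp [rowDifferences]

theorem rowDifferences_smul (c : ℝ) (f : Fin 3 × Fin 2 → ℝ) :
    rowDifferences (c • f) = c • rowDifferences f := by
  ext k
  fin_cases k <;> simp [rowDifferences, mul_sub]

theorem rowMin_smul {c : ℝ} (hc : 0 ≤ c) (u : EuclideanSpace ℝ (Fin 4)) (i : Fin 2) :
    rowMin (c • u) i = c * rowMin u i := by
  fin_cases i <;> simp [rowMin, mul_min_of_nonneg _ _ hc]

theorem coneLift_smul {c : ℝ} (hc : 0 ≤ c) (u : EuclideanSpace ℝ (Fin 4)) :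
    coneLift (c • u) = c • coneLift u := by
  funext ⟨j, i⟩
  simp only [coneLift, rowMin_smul hc, Pi.smul_apply, smul_eq_mul]
  fin_cases j <;> fin_cases i <;> simp [mul_sub]

theorem continuous_rowDifferences : Continuous rowDifferences := by
  refine (PiLp.continuous_toLp 2 _).comp (continuous_pi fun k => ?_)
  fin_cases k <;> simp <;> fun_prop

theorem continuous_coneLift : Continuous coneLift := by
  refine continuous_pi fun ⟨j, i⟩ => ?_
  fin_cases j <;> fin_cases i <;> simp [coneLift, rowMin] <;> fun_prop

theorem rowDifferences_zero : rowDifferences 0 = 0 := by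
  simpa using rowDifferences_smul 0 0

theorem sum_coneLift_pos {u : EuclideanSpace ℝ (Fin 4)} (hu : u ≠ 0) :
    0 < ∑ v, coneLift u v := by
  refine (Finset.sum_nonneg fun v _ => coneLift_nonneg u v).lt_of_ne' fun h => hu ?_
  rw [Finset.sum_eq_zero_iff_of_nonneg fun v _ => coneLift_nonneg u v] at h
  rw [← rowDifferences_coneLift u, show coneLift u = 0 from funext fun v => h v (Finset.mem_univ v),
    rowDifferences_zero]

theorem rowDifferences_ne_zero {f : Fin 3 × Fin 2 → ℝ}
    (hf : f ∈ Realization 3 2 (fun _ => 2) (fun _ => 2)) : rowDifferences f ≠ 0 := by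
  obtain ⟨hnonneg, hsum, hzero⟩ := mem_realization_iff.1 hf
  intro h
  have hf0 : f = 0 := by
    rw [← coneLift_rowDifferences hnonneg hzero, h]
    simpa using coneLift_smul le_rfl (0 : EuclideanSpace ℝ (Fin 4))
  simp [hf0] at hsum

theorem normalized_coneLift_mem_realization {u : EuclideanSpace ℝ (Fin 4)} (hu : u ≠ 0) :
    (∑ v, coneLift u v)⁻¹ • coneLift u ∈ Realization 3 2 (fun _ => 2) (fun _ => 2) := by
  have hpos := sum_coneLift_pos hu
  refine mem_realization_iff.2 ⟨fun v => ?_, ?_, fun i => ?_⟩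
  · exact mul_nonneg (inv_nonneg.2 hpos.le) (coneLift_nonneg u v)
  · simp only [Pi.smul_apply, smul_eq_mul]
    rw [← Finset.mul_sum, inv_mul_cancel₀ hpos.ne']
  · obtain ⟨j, hj⟩ := exists_coneLift_eq_zero u i
    exact ⟨j, by simp [hj]⟩

/-- Radial projection, in the coordinates `rowDifferences`, of the complex onto the sphere. -/
noncomputable def realizationHomeomorphSphere :
    ↥(Realization 3 2 (fun _ => 2) fun _ => 2) ≃ₜ
      Metric.sphere (0 : EuclideanSpace ℝ (Fin 4)) 1 where
  toFun f := ⟨‖rowDifferences f‖⁻¹ • rowDifferences f, by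
    rw [mem_sphere_zero_iff_norm]
    exact norm_smul_inv_norm (𝕜 := ℝ) (rowDifferences_ne_zero f.2)⟩
  invFun u := ⟨(∑ v, coneLift u v)⁻¹ • coneLift u,
    normalized_coneLift_mem_realization (ne_zero_of_mem_unit_sphere u)⟩
  left_inv f := by
    obtain ⟨f, hf⟩ := f
    obtain ⟨hnonneg, hsum, hzero⟩ := mem_realization_iff.1 hf
    have hnorm : ‖rowDifferences f‖ ≠ 0 := norm_ne_zero_iff.2 (rowDifferences_ne_zero hf)
    refine Subtype.ext ?_
    simp only [coneLift_smul (inv_nonneg.2 (norm_nonneg _)),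
      coneLift_rowDifferences hnonneg hzero, Pi.smul_apply, smul_eq_mul, ← Finset.mul_sum, hsum]
    rw [smul_smul, mul_one, inv_inv, mul_inv_cancel₀ hnorm, one_smul]
  right_inv u := by
    have hpos := sum_coneLift_pos (ne_zero_of_mem_unit_sphere u)
    refine Subtype.ext ?_
    simp only [rowDifferences_smul, rowDifferences_coneLift, norm_smul, norm_inv,
      Real.norm_of_nonneg hpos.le, norm_eq_of_mem_sphere u]
    rw [smul_smul, mul_one, inv_inv, mul_inv_cancel₀ hpos.ne', one_smul]
  continuous_toFun := by
    have h := continuous_rowDifferences.comp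
      (continuous_subtype_val (p := (· ∈ Realization 3 2 (fun _ => 2) fun _ => 2)))
    exact ((h.norm.inv₀ fun f => norm_ne_zero_iff.2 (rowDifferences_ne_zero f.2)).smul h).subtype_mk _
  continuous_invFun := by
    have h := continuous_coneLift.comp
      (continuous_subtype_val (p := (· ∈ Metric.sphere (0 : EuclideanSpace ℝ (Fin 4)) 1)))
    have hsum := continuous_finsetSum Finset.univ fun v _ => (continuous_apply v).comp h
    exact ((hsum.inv₀ fun u =>
      (sum_coneLift_pos (ne_zero_of_mem_unit_sphere u)).ne').smul h).subtype_mk _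

theorem delta_3_2_2_2_is_S3 :
    Nonempty (↥(Realization 3 2 (fun _ => 2) fun _ => 2) ≃ₜ
      Metric.sphere (0 : EuclideanSpace ℝ (Fin 4)) 1) :=
  ⟨realizationHomeomorphSphere⟩
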